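/- arXiv:2411.05932 — 3 statements merged into one kernel-verified Lean document; each statement's English description precedes it below -/
import Mathlib

section
/- Let A < B be real numbers and let f : [A,B] → ℝ be continuously differentiable with f(A) ≠ 0, f(B) ≠ 0, such that f′ vanishes at only finitely many points of (A,B) and f is nonzero at every zero of f′. Then the number of zeros of f in (A,B) equals the improper integral (1/(2π))·lim_{M→∞} ∫_{−M}^{M} ( ∫_A^B cos(ξ·f(t))·|f′(t)| dt ) dξ. -/
open Real Set

section DirichletIntegral

open Filter MeasureTheory Topology

theorem integrable_sin_mul_exp_neg_mul (T : ℝ) :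
    Integrable (Function.uncurry fun x y : ℝ => sin x * exp (-x * y))
      ((volume.restrict (Ioc 0 T)).prod (volume.restrict (Ioi 0))) := by
  have hc : Continuous (Function.uncurry fun x y : ℝ => sin x * exp (-x * y)) := by
    unfold Function.uncurry
    fun_prop
  rw [integrable_prod_iff hc.aestronglyMeasurable]
  constructor
  · filter_upwards [ae_restrict_mem measurableSet_Ioc] with x hx
    exact (integrableOn_exp_mul_Ioi (neg_lt_zero.2 hx.1) 0).const_mul (sin x)
  · have hbound : Integrable (fun x => |sinc x|) (volume.restrict (Ioc 0 T)) :=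
      (continuous_sinc.abs.integrableOn_Icc).mono_set Ioc_subset_Icc_self
    refine hbound.congr ?_
    filter_upwards [ae_restrict_mem measurableSet_Ioc] with x hx
    have hx0 : 0 < x := hx.1
    simp only [Function.uncurry_apply_pair, norm_mul, norm_eq_abs, abs_exp]
    rw [integral_const_mul, integral_exp_mul_Ioi (neg_lt_zero.2 hx0), sinc_of_ne_zero hx0.ne',
      abs_div, abs_of_pos hx0]
    simp [div_eq_mul_inv]

theorem integral_sin_mul_exp_neg_mul (T y : ℝ) :
    ∫ x in (0)..T, sin x * exp (-x * y) =
      (1 - exp (-T * y) * (cos T + y * sin T)) * (1 + y ^ 2)⁻¹ := by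
  have hy : 1 + y ^ 2 ≠ 0 := by positivity
  have hd : ∀ x ∈ uIcc 0 T, HasDerivAt
      (fun x => -(exp (-x * y) * (cos x + y * sin x)) * (1 + y ^ 2)⁻¹)
      (sin x * exp (-x * y)) x := by
    intro x _
    have h1 : HasDerivAt (fun x : ℝ => exp (-x * y)) (exp (-x * y) * (-1 * y)) x :=
      (((hasDerivAt_id x).neg).mul_const y).exp
    have h2 : HasDerivAt (fun x : ℝ => cos x + y * sin x) (-sin x + y * cos x) x :=
      (hasDerivAt_cos x).add ((hasDerivAt_sin x).const_mul y)
    refine (((h1.mul h2).neg).mul_const (1 + y ^ 2)⁻¹).congr_deriv ?_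
    field_simp
    ring
  rw [intervalIntegral.integral_eq_sub_of_hasDerivAt hd
    (Continuous.intervalIntegrable (by fun_prop) _ _)]
  simp
  ring

theorem integral_sinc_eq_integral_Ioi {T : ℝ} (hT : 0 ≤ T) :
    ∫ x in (0)..T, sinc x =
      ∫ y in Ioi 0, (1 - exp (-T * y) * (cos T + y * sin T)) * (1 + y ^ 2)⁻¹ := by
  have hswap := integral_integral_swap (integrable_sin_mul_exp_neg_mul T)
  simp_rw [← intervalIntegral.integral_of_le hT, integral_sin_mul_exp_neg_mul] at hswap
  rw [← hswap, intervalIntegral.integral_of_le hT, intervalIntegral.integral_of_le hT]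
  refine setIntegral_congr_fun measurableSet_Ioc fun x hx => ?_
  have hx0 : 0 < x := hx.1
  rw [integral_const_mul, integral_exp_mul_Ioi (neg_lt_zero.2 hx0), sinc_of_ne_zero hx0.ne']
  simp [div_eq_mul_inv]

/-- The **Dirichlet integral**. -/
theorem tendsto_integral_sinc_atTop :
    Tendsto (fun T : ℝ => ∫ x in (0)..T, sinc x) atTop (𝓝 (π / 2)) := by
  have hlim : Tendsto (fun T : ℝ => ∫ y in Ioi (0 : ℝ),
      (1 - exp (-T * y) * (cos T + y * sin T)) * (1 + y ^ 2)⁻¹) atTop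
      (𝓝 (∫ y in Ioi (0 : ℝ), (1 + y ^ 2)⁻¹)) := by
    refine tendsto_integral_filter_of_dominated_convergence (fun y => 3 * (1 + y ^ 2)⁻¹)
      (Eventually.of_forall fun T => ?_) ?_
      ((integrable_inv_one_add_sq.const_mul 3).mono_measure Measure.restrict_le_self) ?_
    · exact Measurable.aestronglyMeasurable (by fun_prop)
    · filter_upwards [eventually_ge_atTop 1] with T hT
      filter_upwards [ae_restrict_mem measurableSet_Ioi] with y hy
      have hy0 : 0 < y := hy
      rw [norm_mul, norm_eq_abs, norm_eq_abs, abs_of_pos (by positivity : 0 < (1 + y ^ 2)⁻¹)]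
      refine mul_le_mul_of_nonneg_right ?_ (by positivity)
      have htrig : |cos T + y * sin T| ≤ 1 + y := by
        refine (abs_add_le _ _).trans (add_le_add (abs_cos_le_one T) ?_)
        rw [abs_mul, abs_of_pos hy0]
        exact mul_le_of_le_one_right hy0.le (abs_sin_le_one T)
      have hexp : exp (-T * y) * (1 + y) ≤ 1 := by
        calc exp (-T * y) * (1 + y) ≤ exp (-y) * exp y := by
              gcongr
              · nlinarith
              · linarith [add_one_le_exp y]
          _ = 1 := by rw [← exp_add]; simp
      have hprod : |exp (-T * y) * (cos T + y * sin T)| ≤ 1 := by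
        rw [abs_mul, abs_exp]
        exact (mul_le_mul_of_nonneg_left htrig (exp_pos _).le).trans hexp
      rw [abs_le] at hprod ⊢
      constructor <;> linarith [hprod.1, hprod.2]
    · filter_upwards [ae_restrict_mem measurableSet_Ioi] with y hy
      have hy0 : 0 < y := hy
      have hexp : Tendsto (fun T : ℝ => exp (-T * y)) atTop (𝓝 0) :=
        tendsto_exp_atBot.comp (tendsto_neg_atTop_atBot.atBot_mul_const hy0)
      have hzero : Tendsto (fun T : ℝ => exp (-T * y) * (cos T + y * sin T)) atTop (𝓝 0) := by
        refine hexp.zero_mul_isBoundedUnder_le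
          (isBoundedUnder_of ⟨1 + y, fun T => (abs_add_le _ _).trans
            (add_le_add (abs_cos_le_one T) ?_)⟩)
        rw [abs_mul, abs_of_pos hy0]
        exact mul_le_of_le_one_right hy0.le (abs_sin_le_one T)
      simpa using (hzero.const_sub 1).mul_const (1 + y ^ 2)⁻¹
  rw [integral_Ioi_inv_one_add_sq, arctan_zero, sub_zero] at hlim
  refine hlim.congr' ?_
  filter_upwards [eventually_ge_atTop 0] with T hT
  exact (integral_sinc_eq_integral_Ioi hT).symm

theorem integral_neg_self_sinc (a : ℝ) :
    ∫ x in (-a)..a, sinc x = 2 * ∫ x in (0)..a, sinc x := by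
  have hi : ∀ a b, IntervalIntegrable sinc volume a b := continuous_sinc.intervalIntegrable
  rw [← intervalIntegral.integral_add_adjacent_intervals (hi (-a) 0) (hi 0 a)]
  have h := intervalIntegral.integral_comp_neg (a := 0) (b := a) sinc
  simp only [sinc_neg, neg_zero] at h
  rw [← h]
  ring

theorem tendsto_integral_mul_sinc_of_pos {x : ℝ} (hx : 0 < x) :
    Tendsto (fun M : ℝ => ∫ ξ in (-M)..M, x * sinc (x * ξ)) atTop (𝓝 π) := by
  have h := (tendsto_integral_sinc_atTop.comp (tendsto_id.const_mul_atTop hx)).const_mul 2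
  rw [mul_div_cancel₀ _ two_ne_zero] at h
  refine h.congr fun M => ?_
  rw [intervalIntegral.integral_const_mul, intervalIntegral.mul_integral_comp_mul_left, mul_neg,
    integral_neg_self_sinc]
  rfl

theorem tendsto_integral_mul_sinc_of_neg {x : ℝ} (hx : x < 0) :
    Tendsto (fun M : ℝ => ∫ ξ in (-M)..M, x * sinc (x * ξ)) atTop (𝓝 (-π)) := by
  refine (tendsto_integral_mul_sinc_of_pos (neg_pos.2 hx)).neg.congr fun M => ?_
  rw [← intervalIntegral.integral_neg]
  simp [sinc_neg]

theorem hasDerivAt_mul_sinc (ξ u : ℝ) :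
    HasDerivAt (fun u => u * sinc (u * ξ)) (cos (ξ * u)) u := by
  rcases eq_or_ne ξ 0 with rfl | hξ
  · simpa using hasDerivAt_id' u
  · have heq : (fun u => u * sinc (u * ξ)) = fun u => sin (ξ * u) / ξ := by
      funext v
      rcases eq_or_ne v 0 with rfl | hv
      · simp
      · rw [sinc_of_ne_zero (mul_ne_zero hv hξ), mul_comm ξ v]
        field_simp
    rw [heq]
    have h := (((hasDerivAt_id u).const_mul ξ).sin).div_const ξ
    simpa [hξ] using! h

end DirichletIntegral

section KacFormula

open Filter MeasureTheory Topology

/-- The inner integral in Kac's formula. -/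
noncomputable def kacIntegral (f f' : ℝ → ℝ) (a b ξ : ℝ) : ℝ :=
  ∫ t in a..b, cos (ξ * f t) * |f' t|

/-- Kac's formula on `[a, b]`, together with the regularity needed to glue intervals. -/
structure KacFormula (f f' : ℝ → ℝ) (a b : ℝ) : Prop where
  finite : {t ∈ Ioo a b | f t = 0}.Finite
  continuous : Continuous (kacIntegral f f' a b)
  tendsto : Tendsto (fun M : ℝ => (1 / (2 * π)) * ∫ ξ in (-M)..M, kacIntegral f f' a b ξ) atTop
    (𝓝 ({t ∈ Ioo a b | f t = 0}.ncard : ℝ))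

theorem intervalIntegrable_cos_mul_abs {f f' : ℝ → ℝ} {a b : ℝ} (hab : a ≤ b)
    (hf : ContinuousOn f (Icc a b)) (hf' : ContinuousOn f' (Icc a b)) (ξ : ℝ) :
    IntervalIntegrable (fun t => cos (ξ * f t) * |f' t|) volume a b := by
  refine ContinuousOn.intervalIntegrable ?_
  rw [uIcc_of_le hab]
  exact (continuous_cos.comp_continuousOn (hf.const_mul ξ)).mul hf'.abs

theorem KacFormula.trans {f f' : ℝ → ℝ} {a c b : ℝ} (hac : a < c) (hcb : c < b)
    (hf : ContinuousOn f (Icc a b)) (hf' : ContinuousOn f' (Icc a b)) (hc : f c ≠ 0)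
    (h₁ : KacFormula f f' a c) (h₂ : KacFormula f f' c b) : KacFormula f f' a b := by
  have hset : {t ∈ Ioo a b | f t = 0} = {t ∈ Ioo a c | f t = 0} ∪ {t ∈ Ioo c b | f t = 0} := by
    ext t
    simp only [mem_ofPred_eq, mem_union, mem_Ioo]
    constructor
    · rintro ⟨⟨h1, h2⟩, h0⟩
      rcases lt_trichotomy t c with h | rfl | h
      · exact .inl ⟨⟨h1, h⟩, h0⟩
      · exact absurd h0 hc
      · exact .inr ⟨⟨h, h2⟩, h0⟩
    · rintro (⟨⟨h1, h2⟩, h0⟩ | ⟨⟨h1, h2⟩, h0⟩)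
      · exact ⟨⟨h1, h2.trans hcb⟩, h0⟩
      · exact ⟨⟨hac.trans h1, h2⟩, h0⟩
  have hdisj : Disjoint {t ∈ Ioo a c | f t = 0} {t ∈ Ioo c b | f t = 0} :=
    Set.disjoint_left.2 fun t h h' => lt_asymm h.1.2 h'.1.1
  have hL : Icc a c ⊆ Icc a b := Icc_subset_Icc_right hcb.le
  have hR : Icc c b ⊆ Icc a b := Icc_subset_Icc_left hac.le
  have hsum : kacIntegral f f' a b = fun ξ => kacIntegral f f' a c ξ + kacIntegral f f' c b ξ := by
    funext ξ
    exact (intervalIntegral.integral_add_adjacent_intervals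
      (intervalIntegrable_cos_mul_abs hac.le (hf.mono hL) (hf'.mono hL) ξ)
      (intervalIntegrable_cos_mul_abs hcb.le (hf.mono hR) (hf'.mono hR) ξ)).symm
  refine ⟨hset ▸ h₁.finite.union h₂.finite, hsum ▸ h₁.continuous.add h₂.continuous, ?_⟩
  rw [hset, ncard_union_eq hdisj h₁.finite h₂.finite, Nat.cast_add]
  refine (h₁.tendsto.add h₂.tendsto).congr fun M => ?_
  rw [hsum, intervalIntegral.integral_add (h₁.continuous.intervalIntegrable _ _)
    (h₂.continuous.intervalIntegrable _ _), mul_add]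

theorem kacFormula_neg_iff {f f' : ℝ → ℝ} {a b : ℝ} :
    KacFormula (-f) (-f') a b ↔ KacFormula f f' a b := by
  have hk : kacIntegral (-f) (-f') a b = kacIntegral f f' a b := by
    funext ξ
    simp [kacIntegral]
  have hs : {t ∈ Ioo a b | (-f) t = 0} = {t ∈ Ioo a b | f t = 0} := by simp
  constructor <;> rintro ⟨h1, h2, h3⟩
  · rw [hk] at h2 h3
    rw [hs] at h1 h3
    exact ⟨h1, h2, h3⟩
  · rw [← hk] at h2 h3
    rw [← hs] at h1 h3
    exact ⟨h1, h2, h3⟩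

theorem kacIntegral_eq_of_pos {f f' : ℝ → ℝ} {a b : ℝ} (hab : a ≤ b)
    (hderiv : ∀ t ∈ Ioo a b, HasDerivAt f (f' t) t)
    (hf : ContinuousOn f (Icc a b)) (hf' : ContinuousOn f' (Icc a b))
    (hpos : ∀ t ∈ Ioo a b, 0 < f' t) (ξ : ℝ) :
    kacIntegral f f' a b ξ = f b * sinc (f b * ξ) - f a * sinc (f a * ξ) := by
  refine intervalIntegral.integral_eq_sub_of_hasDerivAt_of_le
    (f := fun t => f t * sinc (f t * ξ)) hab
    (hf.mul (continuous_sinc.comp_continuousOn (hf.mul_const ξ))) (fun t ht => ?_)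
    (intervalIntegrable_cos_mul_abs hab hf hf' ξ)
  rw [abs_of_pos (hpos t ht)]
  exact (hasDerivAt_mul_sinc ξ (f t)).comp t (hderiv t ht)

theorem kacFormula_of_pos {f f' : ℝ → ℝ} {a b : ℝ} (hab : a < b)
    (hderiv : ∀ t ∈ Ioo a b, HasDerivAt f (f' t) t)
    (hf : ContinuousOn f (Icc a b)) (hf' : ContinuousOn f' (Icc a b))
    (hfa : f a ≠ 0) (hfb : f b ≠ 0) (hpos : ∀ t ∈ Ioo a b, 0 < f' t) : KacFormula f f' a b := by
  have hmono : StrictMonoOn f (Icc a b) := by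
    refine strictMonoOn_of_deriv_pos (convex_Icc a b) hf fun t ht => ?_
    rw [interior_Icc] at ht
    rw [(hderiv t ht).deriv]
    exact hpos t ht
  have hk : kacIntegral f f' a b = fun ξ => f b * sinc (f b * ξ) - f a * sinc (f a * ξ) :=
    funext (kacIntegral_eq_of_pos hab.le hderiv hf hf' hpos)
  have hc : ∀ x : ℝ, Continuous fun ξ => x * sinc (x * ξ) := fun x =>
    continuous_const.mul (continuous_sinc.comp (continuous_const.mul continuous_id))
  have hsub : {t ∈ Ioo a b | f t = 0}.Subsingleton := fun s hs t ht =>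
    hmono.injOn (Ioo_subset_Icc_self hs.1) (Ioo_subset_Icc_self ht.1) (hs.2.trans ht.2.symm)
  refine ⟨hsub.finite, hk ▸ (hc _).sub (hc _), ?_⟩
  have hint : ∀ M : ℝ, ∫ ξ in (-M)..M, kacIntegral f f' a b ξ =
      (∫ ξ in (-M)..M, f b * sinc (f b * ξ)) - ∫ ξ in (-M)..M, f a * sinc (f a * ξ) := fun M => by
    rw [hk, intervalIntegral.integral_sub ((hc _).intervalIntegrable _ _)
      ((hc _).intervalIntegrable _ _)]
  simp_rw [hint]
  have ha : a ∈ Icc a b := left_mem_Icc.2 hab.le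
  have hb : b ∈ Icc a b := right_mem_Icc.2 hab.le
  have hlt : f a < f b := hmono ha hb hab
  rcases hfa.lt_or_gt with ha0 | ha0
  · rcases hfb.lt_or_gt with hb0 | hb0
    · have hempty : {t ∈ Ioo a b | f t = 0} = ∅ := by
        refine eq_empty_of_forall_notMem fun t ht => ?_
        have h := hmono (Ioo_subset_Icc_self ht.1) hb ht.1.2
        linarith [ht.2]
      rw [hempty]
      simpa using ((tendsto_integral_mul_sinc_of_neg hb0).sub
        (tendsto_integral_mul_sinc_of_neg ha0)).const_mul (1 / (2 * π))
    · obtain ⟨c, hc, hc0⟩ := intermediate_value_Ioo hab.le hf ⟨ha0, hb0⟩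
      have hone : {t ∈ Ioo a b | f t = 0} = {c} := hsub.eq_singleton_of_mem ⟨hc, hc0⟩
      rw [hone, ncard_singleton]
      have h := ((tendsto_integral_mul_sinc_of_pos hb0).sub
        (tendsto_integral_mul_sinc_of_neg ha0)).const_mul (1 / (2 * π))
      have hval : 1 / (2 * π) * (π - -π) = ((1 : ℕ) : ℝ) := by
        push_cast
        field_simp
        ring
      rwa [hval] at h
  · have hempty : {t ∈ Ioo a b | f t = 0} = ∅ := by
      refine eq_empty_of_forall_notMem fun t ht => ?_
      have h := hmono ha (Ioo_subset_Icc_self ht.1) ht.1.1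
      linarith [ht.2]
    rw [hempty]
    simpa using ((tendsto_integral_mul_sinc_of_pos (ha0.trans hlt)).sub
      (tendsto_integral_mul_sinc_of_pos ha0)).const_mul (1 / (2 * π))

theorem kacFormula_of_deriv_ne_zero {f f' : ℝ → ℝ} {a b : ℝ} (hab : a < b)
    (hderiv : ∀ t ∈ Ioo a b, HasDerivAt f (f' t) t)
    (hf : ContinuousOn f (Icc a b)) (hf' : ContinuousOn f' (Icc a b))
    (hfa : f a ≠ 0) (hfb : f b ≠ 0) (hne : ∀ t ∈ Ioo a b, f' t ≠ 0) : KacFormula f f' a b := by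
  rcases hasDerivWithinAt_forall_lt_or_forall_gt_of_forall_ne (convex_Ioo a b)
    (fun t ht => (hderiv t ht).hasDerivWithinAt) hne with h | h
  · refine kacFormula_neg_iff.1 (kacFormula_of_pos hab (fun t ht => (hderiv t ht).neg) hf.neg
      hf'.neg (neg_ne_zero.2 hfa) (neg_ne_zero.2 hfb) fun t ht => neg_pos.2 (h t ht))
  · exact kacFormula_of_pos hab hderiv hf hf' hfa hfb h

theorem kacFormula_of_finite {f f' : ℝ → ℝ} {a b : ℝ} (hab : a < b)
    (hderiv : ∀ t ∈ Ioo a b, HasDerivAt f (f' t) t)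
    (hf : ContinuousOn f (Icc a b)) (hf' : ContinuousOn f' (Icc a b))
    (hfa : f a ≠ 0) (hfb : f b ≠ 0) (hfin : {t ∈ Ioo a b | f' t = 0}.Finite)
    (hnz : ∀ t ∈ Ioo a b, f' t = 0 → f t ≠ 0) : KacFormula f f' a b := by
  induction hn : {t ∈ Ioo a b | f' t = 0}.ncard using Nat.strong_induction_on
    generalizing a b with
  | _ n ih =>
    subst hn
    by_cases hne : ∀ t ∈ Ioo a b, f' t ≠ 0
    · exact kacFormula_of_deriv_ne_zero hab hderiv hf hf' hfa hfb hne
    push Not at hne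
    obtain ⟨c, hc, hc0⟩ := hne
    have hfc : f c ≠ 0 := hnz c hc hc0
    have hL : Icc a c ⊆ Icc a b := Icc_subset_Icc_right hc.2.le
    have hR : Icc c b ⊆ Icc a b := Icc_subset_Icc_left hc.1.le
    have hL' : Ioo a c ⊆ Ioo a b := Ioo_subset_Ioo_right hc.2.le
    have hR' : Ioo c b ⊆ Ioo a b := Ioo_subset_Ioo_left hc.1.le
    have hsL : {t ∈ Ioo a c | f' t = 0} ⊂ {t ∈ Ioo a b | f' t = 0} :=
      ⟨fun t ht => ⟨hL' ht.1, ht.2⟩, fun h => lt_irrefl c (h ⟨hc, hc0⟩).1.2⟩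
    have hsR : {t ∈ Ioo c b | f' t = 0} ⊂ {t ∈ Ioo a b | f' t = 0} :=
      ⟨fun t ht => ⟨hR' ht.1, ht.2⟩, fun h => lt_irrefl c (h ⟨hc, hc0⟩).1.1⟩
    refine KacFormula.trans hc.1 hc.2 hf hf' hfc ?_ ?_
    · exact ih _ (ncard_lt_ncard hsL hfin) hc.1 (fun t ht => hderiv t (hL' ht)) (hf.mono hL)
        (hf'.mono hL) hfa hfc (hfin.subset hsL.1) (fun t ht => hnz t (hL' ht)) rfl
    · exact ih _ (ncard_lt_ncard hsR hfin) hc.2 (fun t ht => hderiv t (hR' ht)) (hf.mono hR)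
        (hf'.mono hR) hfc hfb (hfin.subset hsR.1) (fun t ht => hnz t (hR' ht)) rfl

end KacFormula

/-- Kac's counting formula: for a continuously differentiable `f` on `[A,B]` that is
nonzero at the endpoints, whose derivative vanishes at only finitely many points of
`(A,B)`, and with `f` nonzero at every zero of `f'`, the number of zeros of `f` in
`(A,B)` is `(1/(2π)) lim_{M→∞} ∫_{-M}^{M} ∫_A^B cos(ξ f(t)) |f'(t)| dt dξ`. -/
theorem kac_zero_counting_formula (A B : ℝ) (hAB : A < B) (f f' : ℝ → ℝ)
    (hderiv : ∀ t ∈ Icc A B, HasDerivWithinAt f (f' t) (Icc A B) t)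
    (hcont : ContinuousOn f' (Icc A B))
    (hfA : f A ≠ 0) (hfB : f B ≠ 0)
    (hfin : {t ∈ Ioo A B | f' t = 0}.Finite)
    (hnz : ∀ t ∈ Ioo A B, f' t = 0 → f t ≠ 0) :
    Filter.Tendsto (fun M : ℝ =>
        (1 / (2 * π)) * ∫ ξ in (-M)..M, ∫ t in A..B, Real.cos (ξ * f t) * |f' t|)
      Filter.atTop (nhds ((Set.ncard {t ∈ Ioo A B | f t = 0} : ℕ) : ℝ)) := by
  exact (kacFormula_of_finite hAB
    (fun t ht => (hderiv t (Ioo_subset_Icc_self ht)).hasDerivAt (Icc_mem_nhds ht.1 ht.2))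
    (fun t ht => (hderiv t ht).continuousWithinAt) hcont hfA hfB hfin hnz).tendsto
end

section
/- Let k ∈ ℕ and let a₁, …, a_k, γ₁, …, γ_k, t, ξ, η, λ be real numbers. Let Φ₁, …, Φ_k be independent random variables each uniformly distributed on (−π, π), and set f_λ = −λ + Σ_{j=1}^{k} a_j·cos(γ_j·t + Φ_j) and f_λ′ = −Σ_{j=1}^{k} a_j·γ_j·sin(γ_j·t + Φ_j). Then E[ cos(ξ·f_λ)·cos(η·f_λ′) ] = cos(ξ·λ) · Π_{j=1}^{k} g( a_j·√(ξ² + η²·γ_j²) ). -/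
open Real MeasureTheory Set

/-- `g(r) = (1/(2π)) ∫_{-π}^{π} cos(r cos φ) dφ` (the Bessel function `J₀(r)`). -/
noncomputable def g (r : ℝ) : ℝ := (1 / (2 * π)) * ∫ φ in (-π)..π, Real.cos (r * Real.cos φ)

/-- The uniform probability measure on `(-π, π)`. -/
noncomputable def unifMeasure : Measure ℝ :=
  (ENNReal.ofReal (2 * π))⁻¹ • volume.restrict (Ioo (-π) π)

instance : IsProbabilityMeasure unifMeasure := by
  constructor
  have h : ENNReal.ofReal (2 * π) ≠ 0 := by
    simpa using by positivity
  simp only [unifMeasure, Measure.smul_apply, Measure.restrict_apply_univ, Real.volume_Ioo,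
    smul_eq_mul, sub_neg_eq_add, ← two_mul]
  exact ENNReal.inv_mul_cancel h ENNReal.ofReal_ne_top

/-- Integration against the uniform measure is a normalized interval integral. -/
lemma integral_unifMeasure (f : ℝ → ℝ) :
    ∫ φ, f φ ∂unifMeasure = (1 / (2 * π)) * ∫ φ in (-π)..π, f φ := by
  rw [unifMeasure, integral_smul_measure, intervalIntegral.integral_of_le (by linarith [pi_pos]),
    integral_Ioc_eq_integral_Ioo, ENNReal.toReal_inv, ENNReal.toReal_ofReal (by positivity),
    smul_eq_mul, one_div]

/-- The uniform measure integrates `2π`-periodic functions shift-invariantly. -/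
lemma integral_unifMeasure_add {f : ℝ → ℝ} (hf : Function.Periodic f (2 * π)) (c : ℝ) :
    ∫ φ, f (φ + c) ∂unifMeasure = ∫ φ, f φ ∂unifMeasure := by
  rw [integral_unifMeasure, integral_unifMeasure, intervalIntegral.integral_comp_add_right]
  have h := hf.intervalIntegral_add_eq (-π + c) (-π)
  rw [show -π + c + 2 * π = π + c by ring, show -π + 2 * π = π by ring] at h
  rw [h]

lemma integral_cos_unifMeasure (r c : ℝ) :
    ∫ φ, Real.cos (r * Real.cos (φ + c)) ∂unifMeasure = g r := by
  rw [integral_unifMeasure_add (f := fun φ => Real.cos (r * Real.cos φ))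
    (fun φ => by simp only [Real.cos_add_two_pi]) c, integral_unifMeasure, g]

lemma integral_sin_unifMeasure (r c : ℝ) :
    ∫ φ, Real.sin (r * Real.cos (φ + c)) ∂unifMeasure = 0 := by
  have hp : Function.Periodic (fun φ => Real.sin (r * Real.cos φ)) (2 * π) :=
    fun φ => by simp only [Real.cos_add_two_pi]
  have h := integral_unifMeasure_add hp π
  simp only [Real.cos_add_pi, mul_neg, Real.sin_neg, integral_neg] at h
  rw [integral_unifMeasure_add hp c]
  linarith

lemma integral_cexp_unifMeasure (r c : ℝ) :
    ∫ φ, Complex.exp ((r * Real.cos (φ + c) : ℝ) * Complex.I) ∂unifMeasure = g r := by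
  have hi : Integrable (fun φ : ℝ => Complex.exp ((r * Real.cos (φ + c) : ℝ) * Complex.I))
      unifMeasure :=
    (integrable_const (1 : ℝ)).mono' (by fun_prop)
      (.of_forall fun φ => (Complex.norm_exp_ofReal_mul_I _).le)
  apply Complex.ext
  · rw [← integral_cos_unifMeasure r c, Complex.ofReal_re, ← RCLike.re_eq_complex_re,
      ← integral_re hi]
    simp only [RCLike.re_eq_complex_re, Complex.exp_ofReal_mul_I_re]
  · rw [Complex.ofReal_im, ← integral_sin_unifMeasure r c, ← RCLike.im_eq_complex_im,
      ← integral_im hi]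
    simp only [RCLike.im_eq_complex_im, Complex.exp_ofReal_mul_I_im]

lemma exists_phase (x y : ℝ) :
    ∃ α : ℝ, ∀ θ, x * Real.cos θ - y * Real.sin θ = √(x ^ 2 + y ^ 2) * Real.cos (θ + α) := by
  refine ⟨Complex.arg (x + y * Complex.I), fun θ => ?_⟩
  have hc := Complex.norm_mul_cos_arg (x + y * Complex.I)
  have hs := Complex.norm_mul_sin_arg (x + y * Complex.I)
  rw [Complex.norm_add_mul_I] at hc hs
  simp at hc hs
  rw [Real.cos_add]
  linear_combination -Real.cos θ * hc + Real.sin θ * hs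

/-- The characteristic function of `∑ aⱼ (ξ cos θⱼ - η γⱼ sin θⱼ)`, with `θⱼ = γⱼ t + ωⱼ`. -/
lemma integral_cexp_sum {ι : Type*} [Fintype ι] (a γ : ι → ℝ) (t ξ η : ℝ) :
    ∫ ω : ι → ℝ, Complex.exp ((∑ j, a j * (ξ * Real.cos (γ j * t + ω j) -
        η * γ j * Real.sin (γ j * t + ω j)) : ℝ) * Complex.I) ∂(Measure.pi fun _ => unifMeasure) =
      (∏ j, g (a j * √(ξ ^ 2 + η ^ 2 * γ j ^ 2)) : ℝ) := by
  simp only [Complex.ofReal_sum, Finset.sum_mul, Complex.exp_sum]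
  rw [integral_fintype_prod_eq_prod (fun j (x : ℝ) => Complex.exp ((a j *
    (ξ * Real.cos (γ j * t + x) - η * γ j * Real.sin (γ j * t + x)) : ℝ) * Complex.I)),
    Complex.ofReal_prod]
  refine Finset.prod_congr rfl fun j _ => ?_
  obtain ⟨α, hα⟩ := exists_phase ξ (η * γ j)
  rw [← mul_pow, ← integral_cexp_unifMeasure _ (γ j * t + α)]
  refine integral_congr_ae (.of_forall fun x => ?_)
  beta_reduce
  rw [hα, ← mul_assoc (a j), show γ j * t + x + α = x + (γ j * t + α) by ring]

lemma integrable_cexp_sum {ι : Type*} [Fintype ι] (a γ : ι → ℝ) (t ξ η : ℝ) :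
    Integrable (fun ω : ι → ℝ => Complex.exp ((∑ j, a j * (ξ * Real.cos (γ j * t + ω j) -
        η * γ j * Real.sin (γ j * t + ω j)) : ℝ) * Complex.I))
      (Measure.pi fun _ => unifMeasure) :=
  (integrable_const (1 : ℝ)).mono' (by fun_prop)
    (.of_forall fun _ => (Complex.norm_exp_ofReal_mul_I _).le)

lemma integral_cos_add_sum {ι : Type*} [Fintype ι] (a γ : ι → ℝ) (t ξ η c : ℝ) :
    ∫ ω : ι → ℝ, Real.cos (c + ∑ j, a j * (ξ * Real.cos (γ j * t + ω j) -
        η * γ j * Real.sin (γ j * t + ω j))) ∂(Measure.pi fun _ => unifMeasure) =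
      Real.cos c * ∏ j, g (a j * √(ξ ^ 2 + η ^ 2 * γ j ^ 2)) := by
  have hi := (integrable_cexp_sum a γ t ξ η).const_mul (Complex.exp (c * Complex.I))
  have h := congrArg Complex.re (congrArg (Complex.exp (c * Complex.I) * ·)
    (integral_cexp_sum a γ t ξ η))
  simp only [← integral_const_mul] at h
  rw [Complex.re_mul_ofReal, Complex.exp_ofReal_mul_I_re, ← RCLike.re_eq_complex_re,
    ← integral_re hi] at h
  rw [← h]
  refine integral_congr_ae (.of_forall fun ω => ?_)
  simp only [RCLike.re_eq_complex_re, ← Complex.exp_add, ← add_mul, ← Complex.ofReal_add,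
    Complex.exp_ofReal_mul_I_re]

/-- With `Φ₁, …, Φ_k` independent uniform on `(-π,π)` (modelled by the product of uniform
measures), `f_λ = -λ + Σ a_j cos(γ_j t + Φ_j)` and `f_λ' = -Σ a_j γ_j sin(γ_j t + Φ_j)`,
one has `E[cos(ξ f_λ) cos(η f_λ')] = cos(ξλ) Π_j g(a_j √(ξ² + η² γ_j²))`. -/
theorem expectation_cos_random_trig_poly (k : ℕ) (a γ : Fin k → ℝ)
    (t ξ η lam : ℝ) :
    (∫ ω : Fin k → ℝ,
        Real.cos (ξ * (-lam + ∑ j, a j * Real.cos (γ j * t + ω j))) *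
          Real.cos (η * (-∑ j, a j * γ j * Real.sin (γ j * t + ω j)))
        ∂(Measure.pi fun _ => unifMeasure)) =
      Real.cos (ξ * lam) * ∏ j, g (a j * Real.sqrt (ξ ^ 2 + η ^ 2 * (γ j) ^ 2)) := by
  have hi : ∀ η' : ℝ, Integrable (fun ω : Fin k → ℝ => Real.cos (-(ξ * lam) +
      ∑ j, a j * (ξ * Real.cos (γ j * t + ω j) - η' * γ j * Real.sin (γ j * t + ω j))))
      (Measure.pi fun _ => unifMeasure) := fun η' =>
    (integrable_const (1 : ℝ)).mono' (by fun_prop) (.of_forall fun _ => Real.abs_cos_le_one _)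
  have h : ∀ ω : Fin k → ℝ,
      Real.cos (ξ * (-lam + ∑ j, a j * Real.cos (γ j * t + ω j))) *
          Real.cos (η * (-∑ j, a j * γ j * Real.sin (γ j * t + ω j))) =
        (Real.cos (-(ξ * lam) + ∑ j, a j * (ξ * Real.cos (γ j * t + ω j) -
            η * γ j * Real.sin (γ j * t + ω j))) +
          Real.cos (-(ξ * lam) + ∑ j, a j * (ξ * Real.cos (γ j * t + ω j) -
            -η * γ j * Real.sin (γ j * t + ω j)))) / 2 := fun ω => by
    have hs : ∀ η' : ℝ, -(ξ * lam) + ∑ j, a j * (ξ * Real.cos (γ j * t + ω j) -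
            η' * γ j * Real.sin (γ j * t + ω j)) =
        ξ * (-lam + ∑ j, a j * Real.cos (γ j * t + ω j)) +
          η' * (-∑ j, a j * γ j * Real.sin (γ j * t + ω j)) := fun η' => by
      simp only [mul_add, mul_sub, mul_neg, Finset.mul_sum, Finset.sum_sub_distrib]
      rw [add_assoc, ← sub_eq_add_neg]
      congr 2 <;> exact Finset.sum_congr rfl fun j _ => by ring
    rw [hs, hs, neg_mul, ← sub_eq_add_neg, Real.cos_add, Real.cos_sub]
    ring
  simp only [h]
  rw [integral_div, integral_add (hi η) (hi (-η)), integral_cos_add_sum, integral_cos_add_sum,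
    neg_sq, Real.cos_neg]
  ring
end

section
/- There exist constants C > 0 and δ > 0 such that for every k ∈ ℕ and every finite family of real numbers r₁, …, r_k with |r_j| ≤ δ for all j, one has g(r_j) > 0 for each j and | log( Π_{j=1}^{k} g(r_j) ) + (1/4)·Σ_{j=1}^{k} r_j² | ≤ C·Σ_{j=1}^{k} r_j⁴. -/
open Real

theorem integral_one_sub_sq_mul_cos_sq (r : ℝ) :
    ∫ φ in (-π)..π, (1 - (r * Real.cos φ) ^ 2 / 2) = 2 * π * (1 - r ^ 2 / 4) := by
  have h : ∀ φ : ℝ, 1 - (r * Real.cos φ) ^ 2 / 2 = 1 - r ^ 2 / 2 * Real.cos φ ^ 2 := by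
    intro φ
    ring
  simp_rw [h]
  rw [intervalIntegral.integral_sub (Continuous.intervalIntegrable (by fun_prop) _ _)
    (Continuous.intervalIntegrable (by fun_prop) _ _), intervalIntegral.integral_const_mul,
    integral_cos_sq]
  simp
  ring

theorem abs_g_sub_le {r : ℝ} (hr : |r| ≤ 1) : |g r - (1 - r ^ 2 / 4)| ≤ 5 / 96 * r ^ 4 := by
  have hpi := Real.pi_pos
  have hdiff : g r - (1 - r ^ 2 / 4) = 1 / (2 * π) *
      ∫ φ in (-π)..π, (Real.cos (r * Real.cos φ) - (1 - (r * Real.cos φ) ^ 2 / 2)) := by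
    rw [intervalIntegral.integral_sub (Continuous.intervalIntegrable (by fun_prop) _ _)
      (Continuous.intervalIntegrable (by fun_prop) _ _), integral_one_sub_sq_mul_cos_sq, g]
    field_simp
  have hbound : ‖∫ φ in (-π)..π, (Real.cos (r * Real.cos φ) - (1 - (r * Real.cos φ) ^ 2 / 2))‖
      ≤ 5 / 96 * r ^ 4 * |π - -π| := by
    refine intervalIntegral.norm_integral_le_of_norm_le_const fun φ _ => ?_
    have hle : |r * Real.cos φ| ≤ |r| := by
      rw [abs_mul]
      exact mul_le_of_le_one_right (abs_nonneg r) (Real.abs_cos_le_one φ)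
    calc ‖Real.cos (r * Real.cos φ) - (1 - (r * Real.cos φ) ^ 2 / 2)‖
        ≤ |r * Real.cos φ| ^ 4 * (5 / 96) := Real.cos_bound (hle.trans hr)
      _ ≤ |r| ^ 4 * (5 / 96) := by gcongr
      _ = 5 / 96 * r ^ 4 := by rw [Even.pow_abs (by decide)]; ring
  rw [sub_neg_eq_add, abs_of_pos (by positivity : 0 < π + π), Real.norm_eq_abs] at hbound
  rw [hdiff, abs_mul, abs_of_pos (by positivity : 0 < 1 / (2 * π)), one_div_mul_eq_div,
    div_le_iff₀ (by positivity)]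
  linarith

theorem g_pos_and_abs_log_g_add_le {r : ℝ} (hr : |r| ≤ 1) :
    0 < g r ∧ |Real.log (g r) + 1 / 4 * r ^ 2| ≤ r ^ 4 := by
  obtain ⟨hlo, hhi⟩ := abs_le.1 (abs_g_sub_le hr)
  have hr2 : r ^ 2 ≤ 1 := (sq_le_one_iff_abs_le_one r).2 hr
  have hr4 : r ^ 4 ≤ r ^ 2 := by nlinarith [sq_nonneg r]
  have hr4' : 0 ≤ r ^ 4 := by positivity
  have hpos : 0 < g r := by linarith
  refine ⟨hpos, abs_le.2 ⟨?_, ?_⟩⟩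
  · have hlog := Real.one_sub_inv_le_log_of_pos hpos
    have hinv : (g r)⁻¹ ≤ 1 + r ^ 2 / 4 + r ^ 4 := by
      rw [inv_le_iff_one_le_mul₀ hpos]
      have hmul : (1 + r ^ 2 / 4 + r ^ 4) * (1 - r ^ 2 / 4 - 5 / 96 * r ^ 4)
          ≤ (1 + r ^ 2 / 4 + r ^ 4) * g r :=
        mul_le_mul_of_nonneg_left (by linarith) (by positivity)
      have h6 : r ^ 4 * r ^ 2 ≤ r ^ 4 := mul_le_of_le_one_right hr4' hr2
      have h8 : r ^ 4 * r ^ 4 ≤ r ^ 4 := mul_le_of_le_one_right hr4' (hr4.trans hr2)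
      nlinarith
    linarith
  · have hlog := Real.log_le_sub_one_of_pos hpos
    linarith

/-- There are constants `C > 0` and `δ > 0` such that for any finite family of reals
`r₁, …, r_k` with `|r_j| ≤ δ`, each `g(r_j)` is positive and
`|log ∏ g(r_j) + (1/4) Σ r_j²| ≤ C Σ r_j⁴`. -/
theorem log_prod_bessel_approx : ∃ C > (0 : ℝ), ∃ δ > (0 : ℝ),
    ∀ (k : ℕ) (r : Fin k → ℝ), (∀ j, |r j| ≤ δ) →
      (∀ j, 0 < g (r j)) ∧
      |Real.log (∏ j, g (r j)) + (1 / 4) * ∑ j, (r j) ^ 2| ≤ C * ∑ j, (r j) ^ 4 := by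
  refine ⟨1, one_pos, 1, one_pos, fun k r hr => ?_⟩
  have h := fun j => g_pos_and_abs_log_g_add_le (hr j)
  refine ⟨fun j => (h j).1, ?_⟩
  rw [Real.log_prod fun j _ => (h j).1.ne', Finset.mul_sum, ← Finset.sum_add_distrib, one_mul]
  exact (Finset.abs_sum_le_sum_abs _ _).trans (Finset.sum_le_sum fun j _ => (h j).2)
end
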